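/- arXiv:math/0607439 — 2 statements merged into one kernel-verified Lean document; each statement's English description precedes it below -/
import Mathlib

section
/- (Lower bound for the exponential class) Let d ≥ 1 be an integer, 0 < α < 1, 0 < h < 1, 0 < a ≤ 1 ≤ A < ∞. Let N(α) = ⌈log(2^d − 1)/(d·α·log 2)⌉ and let w_α(j) = 2^{dj} for j ≤ N(α) and w_α(j) = 2^{dαj} for j > N(α); let P_α^(d) = P_{w_α,h,a,A}. Then there exists a constant C' > 0 depending only on α, d, h, a, A such that for every n ≥ 1, inf over all classifiers f̂_n of sup over π ∈ P_α^(d) of E_{π^⊗n}[R(f̂_n) − R(f*)] ≥ C' · n^{−(1−α)}. -/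
open MeasureTheory Set
open scoped ENNReal

noncomputable section

/-- Points of `ℝ^d`. -/
abbrev Pt (d : ℕ) : Type := Fin d → ℝ

/-- The unit cube `[0,1]^d`. -/
def unitCube (d : ℕ) : Set (Pt d) := Set.Icc 0 1

/-- Lebesgue measure `λ_d` on `[0,1]^d`. -/
def lamd (d : ℕ) : Measure (Pt d) := volume.restrict (unitCube d)

/-- The dyadic subinterval of `[0,1]` at level `j` with index `k`:
`[k 2^{-j}, (k+1) 2^{-j})` for `k < 2^j - 1` and `[1 - 2^{-j}, 1]` for `k = 2^j - 1`. -/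
def dyadicI (j k : ℕ) : Set ℝ :=
  if k = 2 ^ j - 1 then Set.Icc (1 - ((2 : ℝ) ^ j)⁻¹) 1
  else Set.Ico ((k : ℝ) / 2 ^ j) (((k : ℝ) + 1) / 2 ^ j)

/-- The dyadic cube `I_k^{(j)} ⊆ [0,1]^d` at level `j` with multi-index `k`. -/
def dyadicCube (d j : ℕ) (k : Fin d → ℕ) : Set (Pt d) :=
  {x | ∀ i, x i ∈ dyadicI j (k i)}

/-- `f` is represented by the (automatically countable) family `T` of pairwise disjoint
dyadic cubes whose union has full Lebesgue measure in `[0,1]^d`, with `f` constant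
on each cube of the family. -/
def IsDyadicRep (d : ℕ) (f : Pt d → ℝ) (T : Set (ℕ × (Fin d → ℕ))) : Prop :=
  (∀ p ∈ T, ∀ i, p.2 i < 2 ^ p.1) ∧
  (T.PairwiseDisjoint fun p => dyadicCube d p.1 p.2) ∧
  lamd d (unitCube d \ ⋃ p ∈ T, dyadicCube d p.1 p.2) = 0 ∧
  (∀ p ∈ T, ∀ x ∈ dyadicCube d p.1 p.2, ∀ y ∈ dyadicCube d p.1 p.2, f x = f y)

/-- The class `F^(d)` of measurable `{-1,1}`-valued functions admitting a dyadic
representation. -/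
def memF (d : ℕ) (f : Pt d → ℝ) : Prop :=
  Measurable f ∧ (∀ x, f x = 1 ∨ f x = -1) ∧ ∃ T, IsDyadicRep d f T

/-- The class `F_w^(d)`: a dyadic representation with at most `w j` cubes of side
`2^{-j}` for every level `j`. -/
def memFw (d : ℕ) (w : ℕ → ℝ) (f : Pt d → ℝ) : Prop :=
  Measurable f ∧ (∀ x, f x = 1 ∨ f x = -1) ∧
    ∃ T, IsDyadicRep d f T ∧
      ∀ j, ((T ∩ {p | p.1 = j}).encard : ℝ≥0∞) ≤ ENNReal.ofReal (w j)

/-- Marginal `P^X` of `π` on `[0,1]^d`. -/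
def margX {d : ℕ} (π : Measure (Pt d × ℝ)) : Measure (Pt d) := π.map Prod.fst

/-- The labels of `π` lie in `{-1, 1}` almost surely. -/
def Labels {d : ℕ} (π : Measure (Pt d × ℝ)) : Prop := π {p | p.2 = 1 ∨ p.2 = -1} = 1

/-- `η` is the regression function (conditional probability of `Y = 1`) of `π`. -/
def IsRegression {d : ℕ} (π : Measure (Pt d × ℝ)) (η : Pt d → ℝ) : Prop :=
  Measurable η ∧ (∀ x, η x ∈ Set.Icc (0 : ℝ) 1) ∧
    ∀ s : Set (Pt d), MeasurableSet s →
      π (s ×ˢ {(1 : ℝ)}) = ∫⁻ x in s, ENNReal.ofReal (η x) ∂(margX π)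

/-- The Bayes rule `f*` associated with the regression function `η`. -/
def bayes {d : ℕ} (η : Pt d → ℝ) (x : Pt d) : ℝ := if 1 / 2 ≤ η x then 1 else -1

/-- Misclassification risk `R(f) = π({(x,y) : f(x) ≠ y})`. -/
def risk {d : ℕ} (π : Measure (Pt d × ℝ)) (f : Pt d → ℝ) : ℝ :=
  (π {p | f p.1 ≠ p.2}).toReal

/-- Assumption (A1): `P^X` is absolutely continuous w.r.t. `λ_d` with density
between `a` and `A`. -/
def A1cond {d : ℕ} (π : Measure (Pt d × ℝ)) (a A : ℝ) : Prop :=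
  ∀ s : Set (Pt d), MeasurableSet s →
    ENNReal.ofReal a * lamd d s ≤ margX π s ∧ margX π s ≤ ENNReal.ofReal A * lamd d s

/-- Strong margin assumption (SMA) with margin `h`. -/
def SMAcond {d : ℕ} (π : Measure (Pt d × ℝ)) (η : Pt d → ℝ) (h : ℝ) : Prop :=
  margX π {x | h ≤ |2 * η x - 1|} = 1

/-- Number of indices `i` satisfying `P i`. -/
def cnt (n : ℕ) (P : Fin n → Prop) : ℕ := Nat.card {i // P i}

/-- Index of the level-`J` dyadic interval containing `t ∈ [0,1]`. -/
def dyadicIdx (J : ℕ) (t : ℝ) : ℕ := min ⌊t * 2 ^ J⌋₊ (2 ^ J - 1)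

/-- The level-`J` dyadic cube containing `x ∈ [0,1]^d`. -/
def cubeOf (d J : ℕ) (x : Pt d) : Set (Pt d) := dyadicCube d J fun i => dyadicIdx J (x i)

open Classical in
/-- The dyadic majority-vote classifier `f̂_n^{(J)}` built from the sample `s`. -/
def fhat (d J n : ℕ) (s : Fin n → Pt d × ℝ) (x : Pt d) : ℝ :=
  if (∃ i, (s i).1 ∈ cubeOf d J x) ∧
      cnt n (fun i => (s i).1 ∈ cubeOf d J x ∧ (s i).2 = -1) <
        cnt n (fun i => (s i).1 ∈ cubeOf d J x ∧ (s i).2 = 1)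
  then 1 else -1

/-- The `n`-fold product measure `π^{⊗n}` governing the i.i.d. sample. -/
def sampM {d : ℕ} (π : Measure (Pt d × ℝ)) [SigmaFinite π] (n : ℕ) :
    Measure (Fin n → Pt d × ℝ) := Measure.pi fun _ => π

/-- Expected excess risk `E_{π^{⊗n}}[R(f̂_n) - R(f*)]` of the classifier `F`. -/
def excessExp {d : ℕ} (π : Measure (Pt d × ℝ)) [SigmaFinite π] (η : Pt d → ℝ) (n : ℕ)
    (F : (Fin n → Pt d × ℝ) → Pt d → ℝ) : ℝ :=
  ∫ s, risk π (F s) ∂(sampM π n) - risk π (bayes η)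

/-- The class `P_{w,h,a,A}` of probability measures (together with their regression
functions) satisfying (A1), (SMA), and whose Bayes rule belongs to `F_w^(d)`. -/
def Pclass (d : ℕ) (w : ℕ → ℝ) (h a A : ℝ) :
    Set (ProbabilityMeasure (Pt d × ℝ) × (Pt d → ℝ)) :=
  {p | Labels (p.1 : Measure (Pt d × ℝ)) ∧ IsRegression (p.1 : Measure (Pt d × ℝ)) p.2 ∧
       A1cond (p.1 : Measure (Pt d × ℝ)) a A ∧ SMAcond (p.1 : Measure (Pt d × ℝ)) p.2 h ∧
       memFw d w (bayes p.2)}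

end

/-- The level-`J` dyadic multi-index of a point. -/
noncomputable def dyadicMultiIdx (d J : ℕ) (x : Pt d) (i : Fin d) : ℕ := dyadicIdx J (x i)

theorem dyadicIdx_lt (J : ℕ) (t : ℝ) : dyadicIdx J t < 2 ^ J := by
  have : 0 < 2 ^ J := by positivity
  unfold dyadicIdx
  omega

theorem dyadicIdx_bounds (J : ℕ) {t : ℝ} (h0 : 0 ≤ t) (h1 : t ≤ 1) :
    (dyadicIdx J t : ℝ) / 2 ^ J ≤ t ∧ t ≤ ((dyadicIdx J t : ℝ) + 1) / 2 ^ J := by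
  have hp : (0 : ℝ) < 2 ^ J := by positivity
  have hfl : (⌊t * 2 ^ J⌋₊ : ℝ) ≤ t * 2 ^ J := Nat.floor_le (by positivity)
  rw [div_le_iff₀ hp, le_div_iff₀ hp]
  unfold dyadicIdx
  constructor
  · refine le_trans ?_ hfl
    exact_mod_cast min_le_left _ _
  · rcases min_choice ⌊t * 2 ^ J⌋₊ (2 ^ J - 1) with h | h <;> rw [h]
    · exact (Nat.lt_floor_add_one _).le
    · rw [Nat.cast_sub Nat.one_le_two_pow]
      push_cast
      nlinarith

theorem mem_dyadicI_iff {J k : ℕ} (hk : k < 2 ^ J) (t : ℝ) :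
    t ∈ dyadicI J k ↔ (0 ≤ t ∧ t ≤ 1) ∧ dyadicIdx J t = k := by
  have hp : (0 : ℝ) < 2 ^ J := by positivity
  have hk' : (k : ℝ) + 1 ≤ 2 ^ J := by exact_mod_cast hk
  unfold dyadicI dyadicIdx
  split_ifs with hc
  · have hcr : (k : ℝ) = 2 ^ J - 1 := by
      rw [hc, Nat.cast_sub Nat.one_le_two_pow]
      simp
    have e : 1 - ((2 : ℝ) ^ J)⁻¹ = k / 2 ^ J := by rw [hcr]; field_simp
    rw [mem_Icc, e, div_le_iff₀ hp]
    constructor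
    · rintro ⟨h1, h2⟩
      have : k ≤ ⌊t * 2 ^ J⌋₊ := Nat.le_floor h1
      have h0 : 0 ≤ t := by
        by_contra hneg
        have := mul_neg_of_neg_of_pos (not_le.mp hneg) hp
        have : (0 : ℝ) ≤ k := by positivity
        linarith
      exact ⟨⟨h0, h2⟩, by omega⟩
    · rintro ⟨⟨h0, h1⟩, h2⟩
      have : k ≤ ⌊t * 2 ^ J⌋₊ := by omega
      exact ⟨(Nat.le_floor_iff (by positivity)).mp this, h1⟩
  · rw [mem_Ico, div_le_iff₀ hp, lt_div_iff₀ hp]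
    constructor
    · rintro ⟨h1, h2⟩
      have hk0 : (0 : ℝ) ≤ k := by positivity
      have h0 : 0 ≤ t := by
        by_contra hneg
        have := mul_neg_of_neg_of_pos (not_le.mp hneg) hp
        linarith
      have : ⌊t * 2 ^ J⌋₊ = k := (Nat.floor_eq_iff (by positivity)).mpr ⟨h1, h2⟩
      refine ⟨⟨h0, ?_⟩, by omega⟩
      by_contra hgt
      nlinarith [not_le.mp hgt]
    · rintro ⟨⟨h0, h1⟩, h2⟩
      have : ⌊t * 2 ^ J⌋₊ = k := by omega
      exact (Nat.floor_eq_iff (by positivity)).mp this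

theorem dyadicIdx_coarsen {j J : ℕ} (hj : j ≤ J) (t : ℝ) :
    dyadicIdx j t = dyadicIdx J t / 2 ^ (J - j) := by
  have hpow : 2 ^ J = 2 ^ j * 2 ^ (J - j) := by rw [← pow_add]; congr 1; omega
  have hfl : ⌊t * 2 ^ j⌋₊ = ⌊t * 2 ^ J⌋₊ / 2 ^ (J - j) := by
    rw [← Nat.floor_div_natCast]
    congr 1
    have : (2 : ℝ) ^ J = 2 ^ j * 2 ^ (J - j) := by exact_mod_cast hpow
    push_cast
    rw [this]
    field_simp
  have hlast : 2 ^ j - 1 = (2 ^ J - 1) / 2 ^ (J - j) := by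
    symm
    have h1 : 0 < 2 ^ j := by positivity
    have h2 : 0 < 2 ^ (J - j) := by positivity
    rw [hpow]
    generalize 2 ^ j = a at *
    generalize 2 ^ (J - j) = b at *
    obtain ⟨a, rfl⟩ := Nat.exists_eq_succ_of_ne_zero h1.ne'
    apply Nat.div_eq_of_lt_le
    · simp only [Nat.succ_eq_add_one, Nat.add_sub_cancel]
      have : (a + 1) * b = a * b + b := by ring
      omega
    · simp only [Nat.succ_eq_add_one, Nat.add_sub_cancel]
      have : 0 < (a + 1) * b := by positivity
      omega
  have hmono : Monotone fun k : ℕ => k / 2 ^ (J - j) := fun _ _ h => Nat.div_le_div_right h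
  unfold dyadicIdx
  rw [hfl, hlast]
  exact (hmono.map_min).symm

theorem mem_dyadicCube_iff {d J : ℕ} {k : Fin d → ℕ} (hk : ∀ i, k i < 2 ^ J) (x : Pt d) :
    x ∈ dyadicCube d J k ↔ x ∈ unitCube d ∧ dyadicMultiIdx d J x = k := by
  simp only [dyadicCube, mem_ofPred_eq, mem_dyadicI_iff (hk _), unitCube, mem_Icc, Pi.le_def,
    Pi.zero_apply, Pi.one_apply, funext_iff, dyadicMultiIdx, forall_and]

theorem dyadicMultiIdx_coarsen {d j J : ℕ} (hj : j ≤ J) (x : Pt d) :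
    dyadicMultiIdx d j x = fun i => dyadicMultiIdx d J x i / 2 ^ (J - j) :=
  funext fun i => dyadicIdx_coarsen hj (x i)

theorem measurable_dyadicMultiIdx (d J : ℕ) : Measurable (dyadicMultiIdx d J) := by
  unfold dyadicMultiIdx dyadicIdx
  fun_prop

/-- A tiling of the unit cube: the level-`m` cube at the origin is cut into all of its level-`J`
subcubes, and its complement is tiled by `2 ^ d - 1` cubes at each level `1, …, m`. -/
def spineTiling (d m J : ℕ) : Set (ℕ × (Fin d → ℕ)) :=
  {p | (1 ≤ p.1 ∧ p.1 ≤ m ∧ p.2 ≠ 0 ∧ ∀ i, p.2 i < 2) ∨ (p.1 = J ∧ ∀ i, p.2 i < 2 ^ (J - m))}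

theorem spineTiling_index_lt {d m J : ℕ} :
    ∀ p ∈ spineTiling d m J, ∀ i, p.2 i < 2 ^ p.1 := by
  rintro ⟨j, k⟩ (⟨h1, -, -, h⟩ | ⟨rfl, h⟩) i
  · exact (h i).trans_le (Nat.le_self_pow (by omega) 2)
  · exact (h i).trans_le (Nat.pow_le_pow_right (by norm_num) (by simp))

theorem dyadicMultiIdx_eq_zero_of_le {d j m : ℕ} (hj : j ≤ m) {x : Pt d}
    (hx : dyadicMultiIdx d m x = 0) : dyadicMultiIdx d j x = 0 := by
  rw [dyadicMultiIdx_coarsen hj, hx]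
  ext i
  simp

theorem dyadicMultiIdx_eq_zero_iff {d m J : ℕ} (hm : m ≤ J) {x : Pt d} :
    dyadicMultiIdx d m x = 0 ↔ ∀ i, dyadicMultiIdx d J x i < 2 ^ (J - m) := by
  rw [dyadicMultiIdx_coarsen hm, funext_iff]
  refine forall_congr' fun i => ?_
  simp [Nat.div_eq_zero_iff]

theorem spineTiling_pairwiseDisjoint {d m J : ℕ} (hm : m ≤ J) :
    (spineTiling d m J).PairwiseDisjoint fun p => dyadicCube d p.1 p.2 := by
  have key : ∀ p ∈ spineTiling d m J, ∀ q ∈ spineTiling d m J, p.1 ≤ q.1 → ∀ x,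
      x ∈ dyadicCube d p.1 p.2 → x ∈ dyadicCube d q.1 q.2 → p = q := by
    intro p hp q hq hpq x hxp hxq
    have hp2 := ((mem_dyadicCube_iff (spineTiling_index_lt p hp) x).mp hxp).2
    have hq2 := ((mem_dyadicCube_iff (spineTiling_index_lt q hq) x).mp hxq).2
    rcases hpq.eq_or_lt with h | h
    · rw [h] at hp2
      exact Prod.ext h (hp2.symm.trans hq2)
    exfalso
    rcases hp with ⟨-, hpm, hp0, -⟩ | ⟨hpJ, -⟩
    · apply hp0
      rcases hq with ⟨-, -, -, hq1⟩ | ⟨hqJ, hq1⟩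
      · rw [← hp2, dyadicMultiIdx_coarsen h.le, hq2]
        ext i
        refine Nat.div_eq_of_lt ((hq1 i).trans_le (Nat.le_self_pow (by omega) 2))
      · rw [← hp2]
        refine dyadicMultiIdx_eq_zero_of_le hpm ((dyadicMultiIdx_eq_zero_iff hm).mpr ?_)
        rw [hqJ] at hq2
        rwa [hq2]
    · rcases hq with ⟨-, hqm, -, -⟩ | ⟨hqJ, -⟩ <;> omega
  intro p hp q hq hne
  refine Set.disjoint_left.mpr fun x hxp hxq => hne ?_
  rcases le_total p.1 q.1 with h | h
  · exact key p hp q hq h x hxp hxq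
  · exact (key q hq p hp h x hxq hxp).symm

theorem unitCube_subset_spineTiling {d m J : ℕ} (hm : m ≤ J) :
    unitCube d ⊆ ⋃ p ∈ spineTiling d m J, dyadicCube d p.1 p.2 := by
  intro x hx
  rw [mem_iUnion₂]
  have mem : ∀ j, x ∈ dyadicCube d j (dyadicMultiIdx d j x) := fun j =>
    (mem_dyadicCube_iff (fun i => dyadicIdx_lt j (x i)) x).mpr ⟨hx, rfl⟩
  by_cases h0 : dyadicMultiIdx d m x = 0
  · exact ⟨(J, dyadicMultiIdx d J x), Or.inr ⟨rfl, (dyadicMultiIdx_eq_zero_iff hm).mp h0⟩, mem J⟩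
  · classical
    have hex : ∃ j, dyadicMultiIdx d j x ≠ 0 := ⟨m, h0⟩
    obtain ⟨j, hj, hmin⟩ : ∃ j, dyadicMultiIdx d j x ≠ 0 ∧
        ∀ l < j, dyadicMultiIdx d l x = 0 :=
      ⟨Nat.find hex, Nat.find_spec hex, fun l hl => not_not.mp (Nat.find_min hex hl)⟩
    have hj1 : 1 ≤ j := by
      by_contra hlt
      obtain rfl : j = 0 := by omega
      exact hj (funext fun i => by simp [dyadicMultiIdx, dyadicIdx])
    have hjm : j ≤ m := by
      by_contra hlt
      exact h0 (hmin m (by omega))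
    refine ⟨(j, dyadicMultiIdx d j x), Or.inl ⟨hj1, hjm, hj, fun i => ?_⟩, mem j⟩
    have := (dyadicMultiIdx_eq_zero_iff (Nat.sub_le j 1)).mp (hmin (j - 1) (by omega)) i
    rwa [show j - (j - 1) = 1 by omega, pow_one] at this

theorem spineTiling_encard_le {d m J : ℕ} (hmJ : m < J) {w : ℕ → ℝ}
    (hw1 : ∀ j, 1 ≤ j → j ≤ m → (2 : ℝ) ^ d - 1 ≤ w j)
    (hw2 : (2 : ℝ) ^ (d * (J - m)) ≤ w J) (j : ℕ) :
    ((spineTiling d m J ∩ {p | p.1 = j}).encard : ℝ≥0∞) ≤ ENNReal.ofReal (w j) := by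
  classical
  have bound : ∀ S : Finset (Fin d → ℕ), (S.card : ℝ) ≤ w j →
      (∀ p ∈ spineTiling d m J, p.1 = j → p.2 ∈ S) →
      ((spineTiling d m J ∩ {p | p.1 = j}).encard : ℝ≥0∞) ≤ ENNReal.ofReal (w j) := by
    intro S hS hmem
    have hsub : spineTiling d m J ∩ {p | p.1 = j} ⊆ Prod.mk j '' (S : Set (Fin d → ℕ)) := by
      rintro ⟨l, k⟩ ⟨hp, rfl⟩
      exact ⟨k, hmem _ hp rfl, rfl⟩
    have h1 : (spineTiling d m J ∩ {p | p.1 = j}).encard ≤ (S.card : ℕ∞) := by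
      refine (encard_le_encard hsub).trans ((encard_image_le _ _).trans ?_)
      rw [encard_coe_eq_coe_finsetCard]
    calc ((spineTiling d m J ∩ {p | p.1 = j}).encard : ℝ≥0∞)
        ≤ ((S.card : ℕ∞) : ℝ≥0∞) := by exact_mod_cast h1
      _ = ENNReal.ofReal (S.card : ℝ) := by simp
      _ ≤ _ := ENNReal.ofReal_le_ofReal hS
  rcases eq_or_ne j J with rfl | hjJ
  · refine bound (Fintype.piFinset fun _ => Finset.range (2 ^ (j - m))) ?_ ?_
    · rw [Fintype.card_piFinset]
      simpa [← pow_mul, mul_comm] using hw2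
    · rintro p (⟨-, h, -, -⟩ | ⟨-, h⟩) hpj
      · omega
      · simpa using h
  by_cases hj : 1 ≤ j ∧ j ≤ m
  · refine bound ((Fintype.piFinset fun _ => Finset.range 2).erase 0) ?_ ?_
    · rw [Finset.card_erase_of_mem (by simp), Fintype.card_piFinset]
      have := hw1 j hj.1 hj.2
      simpa [Nat.cast_sub Nat.one_le_two_pow] using this
    · rintro p (⟨-, -, h0, h⟩ | ⟨h, -⟩) hpj
      · simpa [Nat.lt_succ_iff] using And.intro h0 fun i => Nat.le_of_lt_succ (h i)
      · omega
  · have : spineTiling d m J ∩ {p | p.1 = j} = ∅ := by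
      rw [Set.eq_empty_iff_forall_notMem]
      rintro p ⟨⟨h1, h2, -, -⟩ | ⟨h, -⟩, hpj⟩ <;> simp only [mem_ofPred_eq] at hpj <;> omega
    rw [this]
    simp

/-- Sign patterns on the level-`J` dyadic cubes. -/
abbrev SignPattern (d J : ℕ) : Type := (Fin d → Fin (2 ^ J)) → Bool

/-- The level-`J` dyadic multi-index of a point, with values in a finite type. -/
noncomputable def finMultiIdx (d J : ℕ) (x : Pt d) (i : Fin d) : Fin (2 ^ J) :=
  ⟨_, dyadicIdx_lt J (x i)⟩

/-- The function equal to the given sign on each level-`J` subcube of the level-`m` cube at the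
origin, and to `1` elsewhere. -/
noncomputable def signRule {d J : ℕ} (m : ℕ) (σ : SignPattern d J) (x : Pt d) : ℝ :=
  if dyadicMultiIdx d m x = 0 then (if σ (finMultiIdx d J x) then 1 else -1) else 1

theorem measurable_finMultiIdx (d J : ℕ) : Measurable (finMultiIdx d J) := by
  refine measurable_pi_iff.mpr fun i => measurable_to_countable' fun k => ?_
  have : (fun x => finMultiIdx d J x i) ⁻¹' {k} = (fun x => dyadicMultiIdx d J x i) ⁻¹' {k.1} := by
    ext x
    simp [finMultiIdx, dyadicMultiIdx, Fin.ext_iff]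
  rw [this]
  exact ((measurable_pi_apply i).comp (measurable_dyadicMultiIdx d J)) (measurableSet_singleton _)

theorem signRule_eq {d J : ℕ} (m : ℕ) (σ : SignPattern d J) (x : Pt d) :
    signRule m σ x = 1 ∨ signRule m σ x = -1 := by
  unfold signRule
  split_ifs <;> simp

theorem measurable_signRule {d J : ℕ} (m : ℕ) (σ : SignPattern d J) :
    Measurable (signRule m σ) := by
  refine Measurable.ite ?_ ?_ measurable_const
  · exact measurable_dyadicMultiIdx d m (measurableSet_singleton 0)
  · exact (measurable_of_countable fun k => if σ k then (1 : ℝ) else -1).comp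
      (measurable_finMultiIdx d J)

theorem memFw_signRule {d m J : ℕ} (hmJ : m < J) {w : ℕ → ℝ}
    (hw1 : ∀ j, 1 ≤ j → j ≤ m → (2 : ℝ) ^ d - 1 ≤ w j)
    (hw2 : (2 : ℝ) ^ (d * (J - m)) ≤ w J) (σ : SignPattern d J) :
    memFw d w (signRule m σ) := by
  refine ⟨measurable_signRule m σ, signRule_eq m σ, spineTiling d m J,
    ⟨spineTiling_index_lt, spineTiling_pairwiseDisjoint hmJ.le, ?_, ?_⟩,
    spineTiling_encard_le hmJ hw1 hw2⟩
  · rw [sdiff_eq_empty.mpr (unitCube_subset_spineTiling hmJ.le), measure_empty]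
  · intro p hp x hx y hy
    have hx2 := ((mem_dyadicCube_iff (spineTiling_index_lt p hp) x).mp hx).2
    have hy2 := ((mem_dyadicCube_iff (spineTiling_index_lt p hp) y).mp hy).2
    rcases hp with ⟨-, hpm, hp0, -⟩ | ⟨hpJ, -⟩
    · have : ∀ z, dyadicMultiIdx d p.1 z = p.2 → signRule m σ z = 1 := fun z hz =>
        if_neg fun h0 => hp0 (hz.symm.trans (dyadicMultiIdx_eq_zero_of_le hpm h0))
      rw [this x hx2, this y hy2]
    · rw [hpJ] at hx2 hy2
      have hxy : dyadicMultiIdx d J x = dyadicMultiIdx d J y := hx2.trans hy2.symm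
      have h1 : finMultiIdx d J x = finMultiIdx d J y :=
        funext fun i => Fin.ext (congrFun hxy i)
      have h2 : dyadicMultiIdx d m x = dyadicMultiIdx d m y := by
        rw [dyadicMultiIdx_coarsen hmJ.le, dyadicMultiIdx_coarsen hmJ.le, hxy]
      simp only [signRule, h1, h2]

instance isProbabilityMeasure_lamd (d : ℕ) : IsProbabilityMeasure (lamd d) :=
  ⟨by simp [lamd, unitCube, Real.volume_Icc_pi]⟩

theorem lamd_multiIdx_fiber_le (d J : ℕ) (k : Fin d → Fin (2 ^ J)) :
    lamd d {x | finMultiIdx d J x = k} ≤ ENNReal.ofReal (((2 : ℝ) ^ (d * J))⁻¹) := by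
  have hms : MeasurableSet {x | finMultiIdx d J x = k} :=
    measurable_finMultiIdx d J (measurableSet_singleton k)
  rw [lamd, Measure.restrict_apply hms]
  have hsub : {x | finMultiIdx d J x = k} ∩ unitCube d ⊆
      Icc (fun i => ((k i : ℕ) : ℝ) / 2 ^ J) (fun i => (((k i : ℕ) : ℝ) + 1) / 2 ^ J) := by
    rintro x ⟨rfl, h0, h1⟩
    exact ⟨fun i => (dyadicIdx_bounds J (h0 i) (h1 i)).1,
      fun i => (dyadicIdx_bounds J (h0 i) (h1 i)).2⟩
  refine (measure_mono hsub).trans ?_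
  rw [Real.volume_Icc_pi]
  have : ∀ i, (((k i : ℕ) : ℝ) + 1) / 2 ^ J - ((k i : ℕ) : ℝ) / 2 ^ J = (2 ^ J)⁻¹ := by
    intro i; ring
  simp only [this, Finset.prod_const, Finset.card_univ, Fintype.card_fin]
  rw [← ENNReal.ofReal_pow (by positivity), inv_pow, ← pow_mul, mul_comm]

theorem le_lamd_multiIdx_zero (d m : ℕ) :
    ENNReal.ofReal (((2 : ℝ) ^ (d * m))⁻¹) ≤ lamd d {x | dyadicMultiIdx d m x = 0} := by
  have hms : MeasurableSet {x | dyadicMultiIdx d m x = 0} :=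
    measurable_dyadicMultiIdx d m (measurableSet_singleton 0)
  rw [lamd, Measure.restrict_apply hms]
  have hsub : (Set.pi univ fun _ : Fin d => Ico (0 : ℝ) ((2 ^ m)⁻¹)) ⊆
      {x | dyadicMultiIdx d m x = 0} ∩ unitCube d := by
    intro x hx
    have hx' : ∀ i, 0 ≤ x i ∧ x i < (2 ^ m)⁻¹ := fun i => hx i (mem_univ i)
    have hle : ((2 : ℝ) ^ m)⁻¹ ≤ 1 := inv_le_one_of_one_le₀ (one_le_pow₀ (by norm_num))
    refine ⟨funext fun i => ?_, fun i => (hx' i).1, fun i => (hx' i).2.le.trans hle⟩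
    have : ⌊x i * 2 ^ m⌋₊ = 0 := by
      rw [Nat.floor_eq_zero]
      have := (hx' i).2
      rwa [← one_div, lt_div_iff₀ (by positivity)] at this
    simp [dyadicMultiIdx, dyadicIdx, this]
  refine le_trans (le_of_eq ?_) (measure_mono hsub)
  rw [volume_pi_pi]
  simp only [Real.volume_Ico, sub_zero, Finset.prod_const, Finset.card_univ, Fintype.card_fin]
  rw [← ENNReal.ofReal_pow (by positivity), inv_pow, ← pow_mul, mul_comm]

/-- The law of `(X, f X)` with `X` uniform on the unit cube. -/
noncomputable def noiselessLaw {d : ℕ} (f : Pt d → ℝ) : Measure (Pt d × ℝ) :=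
  (lamd d).map fun x => (x, f x)

theorem isProbabilityMeasure_noiselessLaw {d : ℕ} {f : Pt d → ℝ} (hf : Measurable f) :
    IsProbabilityMeasure (noiselessLaw f) :=
  Measure.isProbabilityMeasure_map (by fun_prop)

theorem margX_noiselessLaw {d : ℕ} {f : Pt d → ℝ} (hf : Measurable f) :
    margX (noiselessLaw f) = lamd d := by
  rw [margX, noiselessLaw, Measure.map_map measurable_fst (by fun_prop)]
  exact Measure.map_id

theorem bayes_half_add {d : ℕ} {f : Pt d → ℝ} (hf1 : ∀ x, f x = 1 ∨ f x = -1) :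
    bayes (fun x => (f x + 1) / 2) = f := by
  funext x
  rcases hf1 x with h | h <;> simp only [bayes, h] <;> norm_num

theorem noiselessLaw_mem_Pclass {d : ℕ} {w : ℕ → ℝ} {h a A : ℝ} (hh1 : h ≤ 1) (ha1 : a ≤ 1)
    (hA : 1 ≤ A) {f : Pt d → ℝ} (hf : memFw d w f) (hp : IsProbabilityMeasure (noiselessLaw f)) :
    ((⟨noiselessLaw f, hp⟩ : ProbabilityMeasure (Pt d × ℝ)),
      fun x => (f x + 1) / 2) ∈ Pclass d w h a A := by
  have hfm := hf.1
  have hf1 := hf.2.1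
  have hg : Measurable fun x => (x, f x) := by fun_prop
  change Labels (noiselessLaw f) ∧ IsRegression (noiselessLaw f) (fun x => (f x + 1) / 2) ∧
    A1cond (noiselessLaw f) a A ∧ SMAcond (noiselessLaw f) (fun x => (f x + 1) / 2) h ∧
    memFw d w (bayes fun x => (f x + 1) / 2)
  refine ⟨?_, ⟨by fun_prop, fun x => ?_, fun s hs => ?_⟩, fun s _ => ?_, ?_, ?_⟩
  · have hms : MeasurableSet {p : Pt d × ℝ | p.2 = 1 ∨ p.2 = -1} :=
      (measurable_snd (measurableSet_singleton 1)).union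
        (measurable_snd (measurableSet_singleton (-1)))
    rw [Labels, noiselessLaw, Measure.map_apply hg hms]
    have : (fun x => (x, f x)) ⁻¹' {p : Pt d × ℝ | p.2 = 1 ∨ p.2 = -1} = univ :=
      eq_univ_of_forall hf1
    rw [this, measure_univ]
  · rcases hf1 x with h | h <;> simp only [h] <;> norm_num
  · rw [margX_noiselessLaw hfm, noiselessLaw,
      Measure.map_apply hg (hs.prod (measurableSet_singleton 1))]
    have h1 : (fun x => ENNReal.ofReal ((f x + 1) / 2)) = (f ⁻¹' {1}).indicator 1 := by
      funext x
      rcases hf1 x with h | h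
      · simp [Set.indicator, h]
      · rw [Set.indicator_of_notMem (by simp [h]; norm_num)]
        simp [h]
    have hms : MeasurableSet (f ⁻¹' {1}) := hfm (measurableSet_singleton 1)
    rw [h1, lintegral_indicator_one hms, Measure.restrict_apply hms]
    congr 1
    ext x
    simp [and_comm]
  · rw [margX_noiselessLaw hfm]
    constructor
    · exact mul_le_of_le_one_left (by positivity) (by simpa using ha1)
    · exact le_mul_of_one_le_left (by positivity) (by simpa using hA)
  · rw [SMAcond, margX_noiselessLaw hfm]
    have : {x | h ≤ |2 * ((f x + 1) / 2) - 1|} = univ := by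
      refine eq_univ_of_forall fun x => ?_
      rcases hf1 x with h | h <;> simp [h] <;> norm_num <;> assumption
    rw [this, measure_univ]
  · rwa [bayes_half_add hf1]

theorem risk_noiselessLaw {d : ℕ} {f g : Pt d → ℝ} (hf : Measurable f) (hg : Measurable g) :
    noiselessLaw f {p | g p.1 ≠ p.2} = lamd d {x | g x ≠ f x} := by
  have hms : MeasurableSet {p : Pt d × ℝ | g p.1 ≠ p.2} :=
    (measurableSet_eq_fun (hg.comp measurable_fst) measurable_snd).compl
  rw [noiselessLaw, Measure.map_apply (by fun_prop) hms]
  rfl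

/-- Sample of labelled points from a sample of unlabelled ones. -/
def labelled {d n : ℕ} (f : Pt d → ℝ) (X : Fin n → Pt d) (i : Fin n) : Pt d × ℝ := (X i, f (X i))

theorem measurable_labelled {d n : ℕ} {f : Pt d → ℝ} (hf : Measurable f) :
    Measurable (labelled (n := n) f) := by
  refine measurable_pi_iff.mpr fun i => ?_
  unfold labelled
  fun_prop

theorem excessExp_noiselessLaw {d n : ℕ} {f : Pt d → ℝ} (hf : Measurable f)
    [SigmaFinite (noiselessLaw f)]
    (hf1 : ∀ x, f x = 1 ∨ f x = -1) {F : (Fin n → Pt d × ℝ) → Pt d → ℝ}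
    (hF : Measurable (Function.uncurry F)) :
    excessExp (noiselessLaw f) (fun x => (f x + 1) / 2) n F =
      (∫⁻ X, lamd d {x | F (labelled f X) x ≠ f x} ∂(Measure.pi fun _ : Fin n => lamd d)).toReal := by
  have := isProbabilityMeasure_noiselessLaw hf
  have hFs : ∀ s, Measurable (F s) := fun s => hF.of_uncurry_left
  have hms : MeasurableSet {q : (Fin n → Pt d × ℝ) × Pt d | F q.1 q.2 ≠ f q.2} :=
    (measurableSet_eq_fun hF (hf.comp measurable_snd)).compl
  have hmeas : Measurable fun s => lamd d {x | F s x ≠ f x} := measurable_measure_prodMk_left hms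
  have hpi : sampM (noiselessLaw f) n =
      (Measure.pi fun _ : Fin n => lamd d).map (labelled f) := by
    have h2 : ∀ _ : Fin n, AEMeasurable (fun x => (x, f x)) (lamd d) :=
      fun _ => (by fun_prop : Measurable fun x => (x, f x)).aemeasurable
    rw [sampM]
    exact (Measure.pi_map_pi (hμ := fun _ => inferInstanceAs (SigmaFinite (noiselessLaw f))) h2).symm
  simp only [excessExp, risk, bayes_half_add hf1, risk_noiselessLaw hf (hFs _),
    risk_noiselessLaw hf hf]
  rw [integral_toReal hmeas.aemeasurable (by simp [measure_lt_top]), hpi,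
    lintegral_map hmeas (measurable_labelled hf)]
  simp

theorem bddAbove_excessExp (d n : ℕ) (w : ℕ → ℝ) (h a A : ℝ)
    (F : (Fin n → Pt d × ℝ) → Pt d → ℝ) :
    BddAbove (range fun p : ↥(Pclass d w h a A) =>
      excessExp (p.1.1 : Measure (Pt d × ℝ)) p.1.2 n F) := by
  refine ⟨1, ?_⟩
  rintro _ ⟨p, rfl⟩
  have hle : ∀ s, ‖risk (p.1.1 : Measure (Pt d × ℝ)) (F s)‖ ≤ 1 := fun s => by
    rw [risk, Real.norm_of_nonneg ENNReal.toReal_nonneg]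
    exact measureReal_le_one
  have hsamp : IsProbabilityMeasure (sampM (p.1.1 : Measure (Pt d × ℝ)) n) := by
    unfold sampM
    infer_instance
  have hint := norm_integral_le_of_norm_le_const
    (μ := sampM (p.1.1 : Measure (Pt d × ℝ)) n) (Filter.Eventually.of_forall hle)
  rw [probReal_univ, mul_one] at hint
  have h0 : 0 ≤ risk (p.1.1 : Measure (Pt d × ℝ)) (bayes p.1.2) := ENNReal.toReal_nonneg
  have := le_abs_self (∫ s, risk (p.1.1 : Measure (Pt d × ℝ)) (F s)
    ∂sampM (p.1.1 : Measure (Pt d × ℝ)) n)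
  rw [Real.norm_eq_abs] at hint
  simp only [excessExp]
  linarith

/-- Averaging over all sign patterns: for a point whose cube contains no sample point, half of
the patterns are misclassified. -/
theorem card_le_two_mul_sum_error {d m J n : ℕ} (F : (Fin n → Pt d × ℝ) → Pt d → ℝ)
    {X : Fin n → Pt d} {x : Pt d} (hx : dyadicMultiIdx d m x = 0)
    (hX : ∀ i, finMultiIdx d J (X i) ≠ finMultiIdx d J x) :
    (Fintype.card (SignPattern d J) : ℝ≥0∞) ≤ 2 * ∑ σ : SignPattern d J,
      {x | F (labelled (signRule m σ) X) x ≠ signRule m σ x}.indicator (1 : Pt d → ℝ≥0∞) x := by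
  classical
  set k := finMultiIdx d J x with hk
  let flip : SignPattern d J → SignPattern d J := fun σ => Function.update σ k (!σ k)
  have hflip : Function.Involutive flip := fun σ => by
    simp [flip]
  set g : SignPattern d J → ℝ≥0∞ := fun σ =>
    {x | F (labelled (signRule m σ) X) x ≠ signRule m σ x}.indicator (1 : Pt d → ℝ≥0∞) x with hg
  have hsum : ∑ σ, g (flip σ) = ∑ σ, g σ := Equiv.sum_comp hflip.toPerm g
  have hpt : ∀ σ, 1 ≤ g σ + g (flip σ) := by
    intro σ
    have hlab : labelled (signRule m (flip σ)) X = labelled (signRule m σ) X := by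
      funext i
      simp [labelled, signRule, flip, Function.update_of_ne (hX i)]
    have hne : signRule m (flip σ) x ≠ signRule m σ x := by
      simp only [signRule, hx, flip, ← hk, Function.update_self, if_true]
      cases σ k <;> norm_num
    by_cases h1 : F (labelled (signRule m σ) X) x = signRule m σ x
    · have : g (flip σ) = 1 := by
        refine indicator_of_mem (f := (1 : Pt d → ℝ≥0∞)) ?_
        rw [mem_ofPred_eq, hlab, h1]
        exact hne.symm
      rw [this]
      exact le_add_self
    · have : g σ = 1 := indicator_of_mem (f := (1 : Pt d → ℝ≥0∞)) (by exact h1)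
      rw [this]
      exact le_self_add
  calc (Fintype.card (SignPattern d J) : ℝ≥0∞) = ∑ _σ : SignPattern d J, 1 := by simp
    _ ≤ ∑ σ, (g σ + g (flip σ)) := Finset.sum_le_sum fun σ _ => hpt σ
    _ = 2 * ∑ σ, g σ := by rw [Finset.sum_add_distrib, hsum, two_mul]

theorem quarter_le_pow {K n : ℕ} (hK : 1 ≤ K) (hn : n ≤ 2 * K) :
    (1 / 4 : ℝ) ≤ (1 - ((2 * K : ℕ) : ℝ)⁻¹) ^ n := by
  have hKr : (1 : ℝ) ≤ K := by exact_mod_cast hK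
  have hinv : (((2 * K : ℕ) : ℝ))⁻¹ ≤ 1 / 2 := by
    push_cast
    rw [← one_div]
    exact one_div_le_one_div_of_le (by norm_num) (by linarith)
  have hinv0 : (0 : ℝ) ≤ (((2 * K : ℕ) : ℝ))⁻¹ := by positivity
  have hb : (1 / 2 : ℝ) ≤ (1 - ((2 * K : ℕ) : ℝ)⁻¹) ^ K := by
    have := one_add_mul_le_pow (a := -((2 * K : ℕ) : ℝ)⁻¹) (by linarith) K
    refine le_trans (le_of_eq ?_) (this.trans (le_of_eq (by ring)))
    push_cast
    field_simp
    norm_num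
  calc (1 / 4 : ℝ) = (1 / 2) ^ 2 := by norm_num
    _ ≤ ((1 - ((2 * K : ℕ) : ℝ)⁻¹) ^ K) ^ 2 := by gcongr
    _ = (1 - ((2 * K : ℕ) : ℝ)⁻¹) ^ (2 * K) := by rw [← pow_mul, mul_comm]
    _ ≤ _ := pow_le_pow_of_le_one (by linarith) (by linarith) hn

theorem quarter_le_unseen {d J n : ℕ} (hdJ : 1 ≤ d * J) (hn : n ≤ 2 ^ (d * J))
    (k : Fin d → Fin (2 ^ J)) :
    ENNReal.ofReal (1 / 4) ≤
      (Measure.pi fun _ : Fin n => lamd d) {X | ∀ i, finMultiIdx d J (X i) ≠ k} := by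
  have hset : {X : Fin n → Pt d | ∀ i, finMultiIdx d J (X i) ≠ k} =
      Set.pi univ fun _ => {x | finMultiIdx d J x = k}ᶜ := by
    ext X
    simp
  have hpow : 2 ^ (d * J) = 2 * 2 ^ (d * J - 1) := by
    rw [← pow_succ']
    congr 1
    omega
  have hms : MeasurableSet {x | finMultiIdx d J x = k} :=
    measurable_finMultiIdx d J (measurableSet_singleton k)
  rw [hset, Measure.pi_pi, Finset.prod_const, Finset.card_univ, Fintype.card_fin,
    prob_compl_eq_one_sub hms]
  have hle1 : ((2 : ℝ) ^ (d * J))⁻¹ ≤ 1 := inv_le_one_of_one_le₀ (one_le_pow₀ (by norm_num))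
  have h1 : ENNReal.ofReal (1 - ((2 : ℝ) ^ (d * J))⁻¹) ≤
      1 - lamd d {x | finMultiIdx d J x = k} := by
    rw [ENNReal.ofReal_sub _ (by positivity), ENNReal.ofReal_one]
    exact tsub_le_tsub_left (lamd_multiIdx_fiber_le d J k) 1
  refine le_trans ?_ (pow_le_pow_left₀ (by positivity) h1 n)
  rw [← ENNReal.ofReal_pow (by linarith)]
  refine ENNReal.ofReal_le_ofReal ?_
  have := quarter_le_pow (Nat.one_le_two_pow (n := d * J - 1)) (hn.trans_eq hpow)
  rw [← hpow] at this
  simpa using this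

theorem le_lintegral_unseen {d m J n : ℕ} (hdJ : 1 ≤ d * J) (hn : n ≤ 2 ^ (d * J)) :
    ENNReal.ofReal (1 / 4 * ((2 : ℝ) ^ (d * m))⁻¹) ≤
      ((Measure.pi fun _ : Fin n => lamd d).prod (lamd d))
        {q | dyadicMultiIdx d m q.2 = 0 ∧
          ∀ i, finMultiIdx d J (q.1 i) ≠ finMultiIdx d J q.2} := by
  have hms0 : MeasurableSet {x | dyadicMultiIdx d m x = 0} :=
    measurable_dyadicMultiIdx d m (measurableSet_singleton 0)
  have hms : MeasurableSet {q : (Fin n → Pt d) × Pt d | dyadicMultiIdx d m q.2 = 0 ∧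
      ∀ i, finMultiIdx d J (q.1 i) ≠ finMultiIdx d J q.2} := by
    refine (measurable_snd hms0).inter ?_
    have : {q : (Fin n → Pt d) × Pt d |
        ∀ i, finMultiIdx d J (q.1 i) ≠ finMultiIdx d J q.2} =
        ⋂ i, {q | finMultiIdx d J (q.1 i) = finMultiIdx d J q.2}ᶜ := by
      ext q
      simp
    change MeasurableSet {q : (Fin n → Pt d) × Pt d |
        ∀ i, finMultiIdx d J (q.1 i) ≠ finMultiIdx d J q.2}
    rw [this]
    have hI := measurable_finMultiIdx d J
    exact MeasurableSet.iInter fun i =>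
      (measurableSet_eq_fun (by fun_prop) (by fun_prop)).compl
  rw [Measure.prod_apply_symm hms]
  calc ENNReal.ofReal (1 / 4 * ((2 : ℝ) ^ (d * m))⁻¹)
      = ENNReal.ofReal (1 / 4) * ENNReal.ofReal (((2 : ℝ) ^ (d * m))⁻¹) :=
        ENNReal.ofReal_mul (by norm_num)
    _ ≤ ENNReal.ofReal (1 / 4) * lamd d {x | dyadicMultiIdx d m x = 0} := by
        gcongr
        exact le_lamd_multiIdx_zero d m
    _ = ∫⁻ x, {x | dyadicMultiIdx d m x = 0}.indicator
          (fun _ => ENNReal.ofReal (1 / 4)) x ∂lamd d := (lintegral_indicator_const hms0 _).symm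
    _ ≤ _ := by
        refine lintegral_mono fun x => ?_
        by_cases hx : dyadicMultiIdx d m x = 0
        · rw [indicator_of_mem (by exact hx)]
          refine (quarter_le_unseen hdJ hn (finMultiIdx d J x)).trans (measure_mono fun X hX => ?_)
          exact ⟨hx, hX⟩
        · rw [indicator_of_notMem (by exact hx)]
          exact zero_le

theorem exists_signRule_error {d m J n : ℕ} (hdJ : 1 ≤ d * J) (hn : n ≤ 2 ^ (d * J))
    {F : (Fin n → Pt d × ℝ) → Pt d → ℝ} (hF : Measurable (Function.uncurry F)) :
    ∃ σ : SignPattern d J, ENNReal.ofReal (1 / 8 * ((2 : ℝ) ^ (d * m))⁻¹) ≤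
      ∫⁻ X, lamd d {x | F (labelled (signRule m σ) X) x ≠ signRule m σ x}
        ∂(Measure.pi fun _ : Fin n => lamd d) := by
  by_contra! hcon
  set E : SignPattern d J → ℝ≥0∞ := fun σ =>
    ∫⁻ X, lamd d {x | F (labelled (signRule m σ) X) x ≠ signRule m σ x}
        ∂(Measure.pi fun _ : Fin n => lamd d) with hE
  set S : SignPattern d J → Set ((Fin n → Pt d) × Pt d) := fun σ =>
    {q | F (labelled (signRule m σ) q.1) q.2 ≠ signRule m σ q.2} with hS
  have hSm : ∀ σ, MeasurableSet (S σ) := fun σ => by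
    have h1 : Measurable fun q : (Fin n → Pt d) × Pt d => (labelled (signRule m σ) q.1, q.2) :=
      ((measurable_labelled (measurable_signRule m σ)).comp measurable_fst).prodMk measurable_snd
    exact (measurableSet_eq_fun (hF.comp h1)
      ((measurable_signRule m σ).comp measurable_snd)).compl
  set P := (Measure.pi fun _ : Fin n => lamd d).prod (lamd d) with hP
  have hES : ∀ σ, E σ = P (S σ) := fun σ => (Measure.prod_apply (hSm σ)).symm
  set U : Set ((Fin n → Pt d) × Pt d) := {q | dyadicMultiIdx d m q.2 = 0 ∧
          ∀ i, finMultiIdx d J (q.1 i) ≠ finMultiIdx d J q.2} with hU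
  have hlow : Fintype.card (SignPattern d J) * P U ≤ 2 * ∑ σ, E σ := by
    calc Fintype.card (SignPattern d J) * P U
        ≤ Fintype.card (SignPattern d J) * P {q | (Fintype.card (SignPattern d J) : ℝ≥0∞) ≤
            2 * ∑ σ, (S σ).indicator 1 q} := by
          gcongr
          intro q hq
          exact card_le_two_mul_sum_error F hq.1 hq.2
      _ ≤ ∫⁻ q, 2 * ∑ σ, (S σ).indicator 1 q ∂P := by
          refine mul_meas_ge_le_lintegral ?_ _
          exact (Finset.measurable_fun_sum _ fun σ _ =>
            measurable_one.indicator (hSm σ)).const_mul _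
      _ = 2 * ∑ σ, E σ := by
          rw [lintegral_const_mul _ (Finset.measurable_fun_sum _ fun σ _ =>
              measurable_one.indicator (hSm σ)),
            lintegral_finsetSum _ fun σ _ => measurable_one.indicator (hSm σ)]
          simp only [lintegral_indicator_one (hSm _), hES]
  have hup : ∑ σ, E σ < ∑ _σ : SignPattern d J,
      ENNReal.ofReal (1 / 8 * ((2 : ℝ) ^ (d * m))⁻¹) :=
    ENNReal.sum_lt_sum_of_nonempty Finset.univ_nonempty fun σ _ => hcon σ
  rw [Finset.sum_const, Finset.card_univ, nsmul_eq_mul] at hup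
  have h8 : 2 * ENNReal.ofReal (1 / 8 * ((2 : ℝ) ^ (d * m))⁻¹) =
      ENNReal.ofReal (1 / 4 * ((2 : ℝ) ^ (d * m))⁻¹) := by
    rw [← ENNReal.ofReal_ofNat 2, ← ENNReal.ofReal_mul (by norm_num)]
    congr 1
    ring
  refine absurd (hlow.trans_lt ((ENNReal.mul_lt_mul_iff_right (by norm_num) (by norm_num)).mpr hup))
    (not_lt.mpr ?_)
  rw [mul_left_comm, h8]
  gcongr
  exact le_lintegral_unseen hdJ hn

theorem le_iSup_excessExp {d m J n : ℕ} (hdJ : 1 ≤ d * J) (hn : n ≤ 2 ^ (d * J)) (hmJ : m < J)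
    {w : ℕ → ℝ} (hw1 : ∀ j, 1 ≤ j → j ≤ m → (2 : ℝ) ^ d - 1 ≤ w j)
    (hw2 : (2 : ℝ) ^ (d * (J - m)) ≤ w J) {h a A : ℝ} (hh1 : h ≤ 1) (ha1 : a ≤ 1) (hA : 1 ≤ A)
    {F : (Fin n → Pt d × ℝ) → Pt d → ℝ} (hF : Measurable (Function.uncurry F)) :
    1 / 8 * ((2 : ℝ) ^ (d * m))⁻¹ ≤ ⨆ p : ↥(Pclass d w h a A),
      excessExp (p.1.1 : Measure (Pt d × ℝ)) p.1.2 n F := by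
  obtain ⟨σ, hσ⟩ := exists_signRule_error (m := m) hdJ hn hF
  have hmem := memFw_signRule hmJ hw1 hw2 σ
  have := isProbabilityMeasure_noiselessLaw hmem.1
  refine le_trans ?_ (le_ciSup (bddAbove_excessExp d n w h a A F)
    ⟨_, noiselessLaw_mem_Pclass (h := h) (a := a) (A := A) hh1 ha1 hA hmem this⟩)
  refine le_trans ?_ (excessExp_noiselessLaw hmem.1 hmem.2.1 hF).ge
  refine (ENNReal.ofReal_le_iff_le_toReal ?_).mp hσ
  refine ne_top_of_le_ne_top ENNReal.one_ne_top ((lintegral_mono fun X => prob_le_one).trans ?_)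
  simp

theorem two_pow_sub_one_le_rpow {d : ℕ} (hd : 1 ≤ d) {α : ℝ} (hα0 : 0 < α) {j : ℕ}
    (hj : ⌈Real.log ((2 : ℝ) ^ d - 1) / (d * α * Real.log 2)⌉₊ ≤ j) :
    (2 : ℝ) ^ d - 1 ≤ (2 : ℝ) ^ ((d : ℝ) * α * (j : ℝ)) := by
  have hd' : (0 : ℝ) < d := by exact_mod_cast hd
  have hlog : 0 < Real.log 2 := Real.log_pos (by norm_num)
  have h2 : (2 : ℝ) ≤ 2 ^ d := le_self_pow₀ (by norm_num) (by omega)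
  have hle := Nat.ceil_le.mp hj
  rw [div_le_iff₀ (by positivity)] at hle
  rw [← Real.log_le_log_iff (by linarith) (by positivity), Real.log_rpow (by norm_num)]
  linarith

/-- **Lower bound for the exponential class.** On
`P_α^(d) = P_{w_α,h,a,A}` no classifier can beat the rate `n^{-(1-α)}`. -/
theorem exponential_class_lower_bound (d : ℕ) (hd : 1 ≤ d) (α : ℝ)
    (hα0 : 0 < α) (hα1 : α < 1)
    (h a A : ℝ) (hh : 0 < h) (hh1 : h < 1) (ha : 0 < a) (ha1 : a ≤ 1) (hA : 1 ≤ A) :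
    ∃ C' : ℝ, 0 < C' ∧ ∀ n : ℕ, 1 ≤ n →
      ∀ F : (Fin n → Pt d × ℝ) → Pt d → ℝ, Measurable (Function.uncurry F) →
        (∀ s x, F s x = 1 ∨ F s x = -1) →
          C' * (n : ℝ) ^ (-(1 - α)) ≤
            ⨆ p : ↥(Pclass d
                (fun j => if j ≤ ⌈Real.log ((2 : ℝ) ^ d - 1) / (d * α * Real.log 2)⌉₊
                  then (2 : ℝ) ^ (d * j) else (2 : ℝ) ^ ((d : ℝ) * α * (j : ℝ))) h a A),
              excessExp (p.1.1 : Measure (Pt d × ℝ)) p.1.2 n F := by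
  set J₀ : ℕ := ⌈1 / α⌉₊ + 1 with hJ₀
  set B : ℝ := (2 : ℝ) ^ (d * J₀) * 2 ^ d with hB
  have hBpos : 0 < B := by positivity
  refine ⟨1 / 8 * (2 ^ d)⁻¹ * B ^ (-(1 - α)), by positivity, ?_⟩
  intro n hn F hF _
  have hnr : (0 : ℝ) < n := by exact_mod_cast hn
  set L : ℕ := Nat.clog (2 ^ d) n with hL
  have hb : 1 < 2 ^ d := Nat.one_lt_two_pow (by omega)
  have hnL : n ≤ (2 ^ d) ^ L := Nat.le_pow_clog hb n
  have hLn : (2 ^ d) ^ L ≤ 2 ^ d * n := by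
    rcases Nat.eq_zero_or_pos L with h0 | h0
    · rw [h0, pow_zero]
      exact Nat.one_le_iff_ne_zero.mpr (by positivity)
    · obtain ⟨l, hl⟩ : ∃ l, L = l + 1 := ⟨L - 1, by omega⟩
      have : (2 ^ d) ^ l < n := (Nat.lt_clog_iff_pow_lt hb).mp (by omega)
      rw [hl, pow_succ']
      gcongr
  set J : ℕ := J₀ + L with hJ
  set m : ℕ := ⌈(1 - α) * J⌉₊ with hm
  have hJα : 1 < α * J := by
    have h1 : 1 / α < J := by
      refine (Nat.le_ceil _).trans_lt ?_
      exact_mod_cast (by omega : ⌈1 / α⌉₊ < J)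
    rwa [div_lt_iff₀' hα0] at h1
  have hm1 : (m : ℝ) < (1 - α) * J + 1 :=
    Nat.ceil_lt_add_one (mul_nonneg (by linarith) (by positivity))
  have hm0 : (1 - α) * J ≤ m := Nat.le_ceil _
  have hmJ : m < J := by
    have : (m : ℝ) < J := by linarith
    exact_mod_cast this
  have hdJ : 1 ≤ d * J := Nat.mul_pos hd (by omega)
  have hpowJ : (2 : ℕ) ^ (d * J) = 2 ^ (d * J₀) * (2 ^ d) ^ L := by
    rw [← pow_mul, ← pow_add, ← mul_add]
  have hnJ : n ≤ 2 ^ (d * J) := by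
    rw [hpowJ]
    exact hnL.trans (Nat.le_mul_of_pos_left _ (by positivity))
  refine le_trans ?_ (le_iSup_excessExp (m := m) hdJ hnJ hmJ ?_ ?_ hh1.le ha1 hA hF)
  · have hJB : (2 : ℝ) ^ (d * J) ≤ B * n := by
      have : (2 : ℕ) ^ (d * J) ≤ 2 ^ (d * J₀) * 2 ^ d * n := by
        rw [hpowJ, mul_assoc]
        gcongr
      rw [hB]
      exact_mod_cast this
    have h1 : (B * n) ^ (-(1 - α)) ≤ ((2 : ℝ) ^ (d * J)) ^ (-(1 - α)) :=
      Real.rpow_le_rpow_of_nonpos (by positivity) hJB (by linarith)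
    have h2 : ((2 : ℝ) ^ d)⁻¹ * ((2 : ℝ) ^ (d * J)) ^ (-(1 - α)) ≤ ((2 : ℝ) ^ (d * m))⁻¹ := by
      rw [← Real.rpow_natCast, ← Real.rpow_natCast, ← Real.rpow_natCast,
        ← Real.rpow_mul (by norm_num), ← Real.rpow_neg (by norm_num),
        ← Real.rpow_neg (by norm_num), ← Real.rpow_add (by norm_num)]
      refine Real.rpow_le_rpow_of_exponent_le (by norm_num) ?_
      push_cast
      nlinarith [mul_le_mul_of_nonneg_left hm1.le (Nat.cast_nonneg (α := ℝ) d)]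
    calc 1 / 8 * (2 ^ d)⁻¹ * B ^ (-(1 - α)) * (n : ℝ) ^ (-(1 - α))
        = 1 / 8 * ((2 ^ d)⁻¹ * (B * n) ^ (-(1 - α))) := by
          rw [Real.mul_rpow hBpos.le hnr.le]
          ring
      _ ≤ 1 / 8 * ((2 ^ d)⁻¹ * ((2 : ℝ) ^ (d * J)) ^ (-(1 - α))) := by gcongr
      _ ≤ 1 / 8 * ((2 : ℝ) ^ (d * m))⁻¹ := by gcongr
  · intro j hj1 _
    split_ifs with hj
    · have : (2 : ℝ) ^ d ≤ 2 ^ (d * j) :=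
        pow_le_pow_right₀ (by norm_num) (Nat.le_mul_of_pos_right d hj1)
      linarith
    · exact two_pow_sub_one_le_rpow hd hα0 (by omega)
  · split_ifs with hj
    · exact pow_le_pow_right₀ (by norm_num) (Nat.mul_le_mul_left d (Nat.sub_le J m))
    · rw [← Real.rpow_natCast]
      refine Real.rpow_le_rpow_of_exponent_le (by norm_num) ?_
      rw [Nat.cast_mul, Nat.cast_sub hmJ.le, mul_assoc]
      gcongr
      linarith
end

section
/- Let A ⊆ [0,1]² be a set such that N(∂A, ε, ‖·‖_∞) ≤ δ(ε) for every ε > 0, where δ : (0,∞) → [0,∞) is a decreasing function with ε²·δ(ε) → 0 as ε → 0⁺. Set f_A = 2·1_A − 1. Then for every ε > 0 and every ε₀ ∈ (0,1] with δ(ε₀)·ε₀² ≤ ε, setting J = ⌊log(1/ε₀)/log 2⌋, there exists a function g : [0,1]² → {−1,1} that is constant on each level-J dyadic square of [0,1]² and satisfies ‖g − f_A‖_{L¹(λ₂)} ≤ 36·ε. -/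
open MeasureTheory Set
open scoped ENNReal

/-- `dyadicI` intervals at level `J` are convex. -/
theorem convex_dyadicI (J k : ℕ) : Convex ℝ (dyadicI J k) := by
  unfold dyadicI
  split_ifs
  · exact convex_Icc _ _
  · exact convex_Ico _ _

theorem measurableSet_dyadicI (J k : ℕ) : MeasurableSet (dyadicI J k) := by
  unfold dyadicI
  split_ifs
  · exact measurableSet_Icc
  · exact measurableSet_Ico

theorem dyadicI_subset_Icc {J k : ℕ} (hk : k < 2 ^ J) :
    dyadicI J k ⊆ Set.Icc ((k : ℝ) / 2 ^ J) (((k : ℝ) + 1) / 2 ^ J) := by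
  have hJ : (0 : ℝ) < 2 ^ J := by positivity
  unfold dyadicI
  split_ifs with h
  · have hk1 : (k : ℝ) + 1 = 2 ^ J := by
      have : k + 1 = 2 ^ J := by omega
      exact_mod_cast this
    have hk2 : (k : ℝ) / 2 ^ J = 1 - ((2 : ℝ) ^ J)⁻¹ := by
      rw [show (k : ℝ) = 2 ^ J - 1 by linarith]
      field_simp
    rw [hk2, hk1, div_self hJ.ne']
  · exact Set.Ico_subset_Icc_self

theorem dyadicIdx_eq_of_mem {J k : ℕ} (hk : k < 2 ^ J) {t : ℝ} (ht : t ∈ dyadicI J k) :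
    dyadicIdx J t = k := by
  have hJ : (0 : ℝ) < 2 ^ J := by positivity
  obtain ⟨h1, -⟩ := dyadicI_subset_Icc hk ht
  rw [div_le_iff₀ hJ] at h1
  have hle : k ≤ ⌊t * 2 ^ J⌋₊ := Nat.le_floor h1
  unfold dyadicI at ht
  unfold dyadicIdx
  split_ifs at ht with h
  · omega
  · have h2 := ht.2
    rw [lt_div_iff₀ hJ] at h2
    have : ⌊t * 2 ^ J⌋₊ < k + 1 :=
      (Nat.floor_lt' (by omega)).2 (by push_cast; exact h2)
    omega

theorem mem_dyadicI_dyadicIdx (J : ℕ) {t : ℝ} (h0 : 0 ≤ t) (h1 : t ≤ 1) :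
    t ∈ dyadicI J (dyadicIdx J t) := by
  have hJ : (0 : ℝ) < 2 ^ J := by positivity
  have hfl : (⌊t * 2 ^ J⌋₊ : ℝ) ≤ t * 2 ^ J := Nat.floor_le (by positivity)
  have hlt := Nat.lt_floor_add_one (t * 2 ^ J)
  unfold dyadicI
  split_ifs with h
  · refine ⟨?_, h1⟩
    have hle : 2 ^ J - 1 ≤ ⌊t * 2 ^ J⌋₊ := by
      unfold dyadicIdx at h
      omega
    have hle' : (2 : ℝ) ^ J ≤ ⌊t * 2 ^ J⌋₊ + 1 := by
      have : 2 ^ J ≤ ⌊t * 2 ^ J⌋₊ + 1 := by omega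
      exact_mod_cast this
    have : 1 - ((2 : ℝ) ^ J)⁻¹ = (2 ^ J - 1) / 2 ^ J := by field_simp
    rw [this, div_le_iff₀ hJ]
    linarith
  · have he : dyadicIdx J t = ⌊t * 2 ^ J⌋₊ := by
      unfold dyadicIdx at h ⊢
      omega
    rw [he]
    exact ⟨(div_le_iff₀ hJ).2 hfl, (lt_div_iff₀ hJ).2 hlt⟩

theorem measurable_dyadicIdx (J : ℕ) : Measurable (dyadicIdx J) := by
  unfold dyadicIdx
  exact (Nat.measurable_floor.comp (measurable_id.mul_const _)).min measurable_const

theorem convex_dyadicCube (d J : ℕ) (k : Fin d → ℕ) : Convex ℝ (dyadicCube d J k) := by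
  have : dyadicCube d J k = Set.univ.pi fun i => dyadicI J (k i) := by
    ext x
    simp [dyadicCube]
  rw [this]
  exact convex_pi fun i _ => convex_dyadicI J (k i)

theorem measurableSet_dyadicCube (d J : ℕ) (k : Fin d → ℕ) :
    MeasurableSet (dyadicCube d J k) := by
  have : dyadicCube d J k = Set.univ.pi fun i => dyadicI J (k i) := by
    ext x
    simp [dyadicCube]
  rw [this]
  exact MeasurableSet.univ_pi fun i => measurableSet_dyadicI J (k i)

theorem dist_le_of_mem_dyadicCube {d J : ℕ} {k : Fin d → ℕ} (hk : ∀ i, k i < 2 ^ J)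
    {x y : Pt d} (hx : x ∈ dyadicCube d J k) (hy : y ∈ dyadicCube d J k) :
    dist x y ≤ ((2 : ℝ) ^ J)⁻¹ := by
  refine (dist_pi_le_iff (by positivity)).2 fun i => ?_
  refine (Real.dist_le_of_mem_Icc (dyadicI_subset_Icc (hk i) (hx i))
    (dyadicI_subset_Icc (hk i) (hy i))).trans (le_of_eq ?_)
  field_simp
  ring

/-- Multi-indices of the level-`J` dyadic cubes. -/
def dyadicIndices (d J : ℕ) : Finset (Fin d → ℕ) :=
  Fintype.piFinset fun _ => Finset.range (2 ^ J)

theorem mem_dyadicIndices {d J : ℕ} {k : Fin d → ℕ} :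
    k ∈ dyadicIndices d J ↔ ∀ i, k i < 2 ^ J := by
  simp [dyadicIndices]

theorem dyadicIdx_comp_eq_of_mem {d J : ℕ} {k : Fin d → ℕ} (hk : ∀ i, k i < 2 ^ J)
    {x : Pt d} (hx : x ∈ dyadicCube d J k) : (fun i => dyadicIdx J (x i)) = k :=
  funext fun i => dyadicIdx_eq_of_mem (hk i) (hx i)

theorem dyadicCube_subset_unitCube {d J : ℕ} {k : Fin d → ℕ} (hk : ∀ i, k i < 2 ^ J) :
    dyadicCube d J k ⊆ unitCube d := by
  intro x hx
  have hJ : (0 : ℝ) < 2 ^ J := by positivity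
  refine ⟨fun i => ?_, fun i => ?_⟩
  · exact le_trans (by positivity) (dyadicI_subset_Icc (hk i) (hx i)).1
  · refine (dyadicI_subset_Icc (hk i) (hx i)).2.trans ((div_le_one hJ).2 ?_)
    have := hk i
    exact_mod_cast this

theorem unitCube_eq_biUnion (d J : ℕ) :
    unitCube d = ⋃ k ∈ dyadicIndices d J, dyadicCube d J k := by
  refine Set.Subset.antisymm (fun x hx => ?_) (Set.iUnion₂_subset fun k hk =>
    dyadicCube_subset_unitCube (mem_dyadicIndices.1 hk))
  exact Set.mem_biUnion (x := fun i => dyadicIdx J (x i))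
    (mem_dyadicIndices.2 fun i => dyadicIdx_lt J _)
    fun i => mem_dyadicI_dyadicIdx J (hx.1 i) (hx.2 i)

theorem pairwiseDisjoint_dyadicCube (d J : ℕ) :
    (dyadicIndices d J : Set (Fin d → ℕ)).PairwiseDisjoint (dyadicCube d J) := by
  intro k hk l hl hne
  refine Set.disjoint_left.2 fun x hx hx' => hne ?_
  rw [← dyadicIdx_comp_eq_of_mem (mem_dyadicIndices.1 hk) hx,
    dyadicIdx_comp_eq_of_mem (mem_dyadicIndices.1 hl) hx']

theorem volume_dyadicCube_ne_top {d J : ℕ} {k : Fin d → ℕ} (hk : ∀ i, k i < 2 ^ J) :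
    volume (dyadicCube d J k) ≠ ∞ :=
  measure_ne_top_of_subset (dyadicCube_subset_unitCube hk)
    (isCompact_Icc (a := (0 : Pt d)) (b := 1)).measure_ne_top

/-- A union of `N` sup-norm balls of radius `r` in the plane has area at most `4 N r²`. -/
theorem volume_iUnion_closedBall_le {N : ℕ} (c : Fin N → Pt 2) {r : ℝ} (hr : 0 ≤ r) :
    volume (⋃ i, Metric.closedBall (c i) r) ≤ ENNReal.ofReal (N * (2 * r) ^ 2) := by
  refine (measure_iUnion_fintype_le _ _).trans (le_of_eq ?_)
  simp only [Real.volume_pi_closedBall _ hr, Fintype.card_fin, Finset.sum_const,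
    Finset.card_univ, nsmul_eq_mul]
  rw [ENNReal.ofReal_mul (by positivity), ENNReal.ofReal_natCast]

/-- A planar set whose covering numbers at scale `ε` are `o(ε⁻²)` is Lebesgue-null. -/
theorem volume_eq_zero_of_covering {S : Set (Pt 2)} {δ : ℝ → ℝ}
    (hδ0 : Filter.Tendsto (fun ε => ε ^ 2 * δ ε) (nhdsWithin 0 (Set.Ioi 0)) (nhds 0))
    (hcov : ∀ ε, 0 < ε → ∃ (N : ℕ) (c : Fin N → Pt 2), (N : ℝ) ≤ δ ε ∧
      S ⊆ ⋃ i, Metric.closedBall (c i) ε) :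
    volume S = 0 := by
  have hlim : Filter.Tendsto (fun ε => ENNReal.ofReal (4 * (ε ^ 2 * δ ε)))
      (nhdsWithin 0 (Set.Ioi 0)) (nhds 0) := by
    have := ENNReal.tendsto_ofReal (hδ0.const_mul 4)
    simpa using this
  refine le_antisymm (ge_of_tendsto hlim ?_) zero_le
  filter_upwards [self_mem_nhdsWithin] with η hη
  have hη : 0 < η := hη
  obtain ⟨N, c, hN, hsub⟩ := hcov η hη
  refine (measure_mono hsub).trans ((volume_iUnion_closedBall_le c hη.le).trans
    (ENNReal.ofReal_le_ofReal ?_))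
  nlinarith [mul_le_mul_of_nonneg_right hN (sq_nonneg η)]

/-- The sign of the majority of `A` inside `Q`. -/
noncomputable def majoritySign (A Q : Set (Pt 2)) : ℝ :=
  if volume.real (Q \ A) ≤ volume.real (Q ∩ A) then 1 else -1

theorem majoritySign_eq (A Q : Set (Pt 2)) : majoritySign A Q = 1 ∨ majoritySign A Q = -1 := by
  unfold majoritySign
  split_ifs <;> simp

theorem setIntegral_abs_majoritySign_sub {A Q : Set (Pt 2)} (hA : NullMeasurableSet A volume) :
    ∫ x in Q, |majoritySign A Q - (2 * Set.indicator A (fun _ => (1 : ℝ)) x - 1)| =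
      2 * min (volume.real (Q ∩ A)) (volume.real (Q \ A)) := by
  have key : ∀ B : Set (Pt 2), NullMeasurableSet B volume →
      ∫ x in Q, 2 * Set.indicator B (fun _ => (1 : ℝ)) x = 2 * volume.real (Q ∩ B) := by
    intro B hB
    have hBQ : NullMeasurableSet B (volume.restrict Q) :=
      hB.mono_ac Measure.absolutelyContinuous_restrict
    rw [integral_const_mul, integral_indicator₀ hBQ, setIntegral_const, smul_eq_mul, mul_one,
      measureReal_def, Measure.restrict_apply₀ hBQ, Set.inter_comm, measureReal_def]
  unfold majoritySign
  split_ifs with h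
  · rw [min_eq_right h, Set.sdiff_eq, ← key Aᶜ hA.compl]
    congr 1 with x
    by_cases hx : x ∈ A
    · norm_num [hx]
    · norm_num [hx]
  · rw [min_eq_left (not_le.1 h).le, ← key A hA]
    congr 1 with x
    by_cases hx : x ∈ A
    · norm_num [hx]
    · norm_num [hx]

theorem two_mul_min_measureReal_le {A Q : Set (Pt 2)} (hA : NullMeasurableSet A volume)
    (hQ : volume Q ≠ ∞) :
    2 * min (volume.real (Q ∩ A)) (volume.real (Q \ A)) ≤ volume.real Q := by
  rw [← measureReal_inter_add_sdiff₀ hA hQ]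
  linarith [min_le_left (volume.real (Q ∩ A)) (volume.real (Q \ A)),
    min_le_right (volume.real (Q ∩ A)) (volume.real (Q \ A))]

/-- A preconnected set meeting both `A` and its complement meets the frontier of `A`. -/
theorem IsPreconnected.inter_frontier_nonempty_of_inter_nonempty {X : Type*} [TopologicalSpace X]
    {Q A : Set X} (hQ : IsPreconnected Q) (h1 : (Q ∩ A).Nonempty) (h2 : (Q \ A).Nonempty) :
    (Q ∩ frontier A).Nonempty := by
  by_contra hne
  have hfr : ∀ x ∈ Q, x ∈ closure A → x ∈ interior A := fun x hx hc => by
    by_contra hi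
    exact hne ⟨x, hx, hc, hi⟩
  obtain ⟨x, hxQ, hxA⟩ := h1
  obtain ⟨y, hyQ, hyA⟩ := h2
  obtain ⟨z, -, hzi, hzc⟩ := hQ (interior A) (closure A)ᶜ isOpen_interior
    isClosed_closure.isOpen_compl
    (fun z hz => (em (z ∈ closure A)).imp (hfr z hz) id)
    ⟨x, hxQ, hfr x hxQ (subset_closure hxA)⟩
    ⟨y, hyQ, fun hc => hyA (interior_subset (hfr y hyQ hc))⟩
  exact hzc (subset_closure (interior_subset hzi))

theorem min_measureReal_eq_zero {A Q : Set (Pt 2)} (hQ : IsPreconnected Q)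
    (h : ¬ (Q ∩ frontier A).Nonempty) :
    min (volume.real (Q ∩ A)) (volume.real (Q \ A)) = 0 := by
  by_cases h1 : (Q ∩ A).Nonempty
  · have h2 : Q \ A = ∅ := by
      by_contra h2
      exact h (hQ.inter_frontier_nonempty_of_inter_nonempty h1 (Set.nonempty_iff_ne_empty.2 h2))
    simp [h2, measureReal_nonneg]
  · simp [Set.not_nonempty_iff_eq_empty.1 h1, measureReal_nonneg]

theorem inv_two_pow_floor_log_le {ε₀ : ℝ} (h0 : 0 < ε₀) :
    ((2 : ℝ) ^ ⌊Real.log (1 / ε₀) / Real.log 2⌋₊)⁻¹ ≤ 2 * ε₀ := by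
  have hl2 : 0 < Real.log 2 := Real.log_pos (by norm_num)
  have h := Nat.lt_floor_add_one (Real.log (1 / ε₀) / Real.log 2)
  set J := ⌊Real.log (1 / ε₀) / Real.log 2⌋₊
  have hlog : Real.log (1 / ε₀) < Real.log ((2 : ℝ) ^ (J + 1)) := by
    rw [Real.log_pow]
    push_cast
    exact (div_lt_iff₀ hl2).1 h
  have h2 := (Real.log_lt_log_iff (by positivity) (by positivity)).1 hlog
  rw [div_lt_iff₀ h0, pow_succ] at h2
  rw [inv_le_iff_one_le_mul₀ (by positivity)]
  linarith

/-- If the boundary of `A ⊆ [0,1]²` has `ε`-covering numbers (for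
the sup norm) bounded by `δ(ε)`, then for any `ε₀ ∈ (0,1]` with `δ(ε₀)ε₀² ≤ ε`, the
function `f_A = 2·1_A - 1` is approximated within `36ε` in `L¹(λ₂)` by a
`{-1,1}`-valued function constant on each dyadic square of level
`J = ⌊log(1/ε₀)/log 2⌋`. -/
theorem border_covering_approximation (A : Set (Pt 2)) (hA : A ⊆ unitCube 2)
    (δ : ℝ → ℝ) (hδnn : ∀ ε, 0 < ε → 0 ≤ δ ε)
    (hδanti : ∀ ε₁ ε₂, 0 < ε₁ → ε₁ ≤ ε₂ → δ ε₂ ≤ δ ε₁)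
    (hδ0 : Filter.Tendsto (fun ε => ε ^ 2 * δ ε) (nhdsWithin 0 (Set.Ioi 0)) (nhds 0))
    (hcov : ∀ ε, 0 < ε → ∃ (N : ℕ) (c : Fin N → Pt 2), (N : ℝ) ≤ δ ε ∧
      frontier A ⊆ ⋃ i, Metric.closedBall (c i) ε)
    (ε ε₀ : ℝ) (hε : 0 < ε) (hε₀ : ε₀ ∈ Set.Ioc (0 : ℝ) 1) (hle : δ ε₀ * ε₀ ^ 2 ≤ ε) :
    ∃ g : Pt 2 → ℝ, Measurable g ∧ (∀ x, g x = 1 ∨ g x = -1) ∧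
      (∀ k : Fin 2 → ℕ, (∀ i, k i < 2 ^ ⌊Real.log (1 / ε₀) / Real.log 2⌋₊) →
        ∀ x ∈ dyadicCube 2 ⌊Real.log (1 / ε₀) / Real.log 2⌋₊ k,
          ∀ y ∈ dyadicCube 2 ⌊Real.log (1 / ε₀) / Real.log 2⌋₊ k, g x = g y) ∧
      ∫ x, |g x - (2 * Set.indicator A (fun _ => (1 : ℝ)) x - 1)| ∂(lamd 2) ≤ 36 * ε := by
  classical
  have hpos := hε₀.1
  have hs := inv_two_pow_floor_log_le hpos
  set J := ⌊Real.log (1 / ε₀) / Real.log 2⌋₊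
  have hAm : NullMeasurableSet A volume :=
    nullMeasurableSet_of_null_frontier (volume_eq_zero_of_covering hδ0 hcov)
  set g : Pt 2 → ℝ := fun x => majoritySign A (cubeOf 2 J x)
  have hgQ : ∀ k : Fin 2 → ℕ, (∀ i, k i < 2 ^ J) → ∀ x ∈ dyadicCube 2 J k,
      g x = majoritySign A (dyadicCube 2 J k) := by
    intro k hk x hx
    simp only [g, cubeOf, dyadicIdx_comp_eq_of_mem hk hx]
  have hgm : Measurable g :=
    (Measurable.of_discrete (f := fun k : Fin 2 → ℕ => majoritySign A (dyadicCube 2 J k))).comp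
      (measurable_pi_lambda _ fun i => (measurable_dyadicIdx J).comp (measurable_pi_apply i))
  refine ⟨g, hgm, fun x => majoritySign_eq _ _, fun k hk x hx y hy => ?_, ?_⟩
  · rw [hgQ k hk x hx, hgQ k hk y hy]
  have hint : IntegrableOn
      (fun x => |g x - (2 * Set.indicator A (fun _ => (1 : ℝ)) x - 1)|) (unitCube 2) volume := by
    have hfin : volume (unitCube 2) ≠ ∞ :=
      (isCompact_Icc (a := (0 : Pt 2)) (b := 1)).measure_ne_top
    refine IntegrableOn.of_bound (C := 2) hfin.lt_top ?_ (Filter.Eventually.of_forall fun x => ?_)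
    · have hAQ : NullMeasurableSet A (volume.restrict (unitCube 2)) :=
        hAm.mono_ac Measure.absolutelyContinuous_restrict
      have hind : AEMeasurable (Set.indicator A fun _ => (1 : ℝ))
          (volume.restrict (unitCube 2)) := aemeasurable_const.indicator₀ hAQ
      exact (continuous_abs.measurable.comp_aemeasurable
        (hgm.aemeasurable.sub ((hind.const_mul 2).sub_const 1))).aestronglyMeasurable
    · rw [Real.norm_eq_abs, abs_abs]
      rcases majoritySign_eq A (cubeOf 2 J x) with h | h <;> by_cases hx : x ∈ A <;>
        simp [g, h, hx] <;> norm_num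
  have hsum : ∫ x, |g x - (2 * Set.indicator A (fun _ => (1 : ℝ)) x - 1)| ∂(lamd 2) =
      ∑ k ∈ dyadicIndices 2 J, 2 * min (volume.real (dyadicCube 2 J k ∩ A))
        (volume.real (dyadicCube 2 J k \ A)) := by
    rw [lamd]
    rw [unitCube_eq_biUnion 2 J, integral_biUnion_finset _
      (fun k _ => measurableSet_dyadicCube 2 J k) (pairwiseDisjoint_dyadicCube 2 J)
      (fun k hk => hint.mono_set (dyadicCube_subset_unitCube (mem_dyadicIndices.1 hk)))]
    refine Finset.sum_congr rfl fun k hk => ?_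
    rw [← setIntegral_abs_majoritySign_sub hAm]
    refine setIntegral_congr_fun (measurableSet_dyadicCube 2 J k) fun x hx => ?_
    simp only [hgQ k (mem_dyadicIndices.1 hk) x hx]
  set bad := (dyadicIndices 2 J).filter fun k => (dyadicCube 2 J k ∩ frontier A).Nonempty
  obtain ⟨N, c, hN, hsub⟩ := hcov ε₀ hpos
  have hbad : ⋃ k ∈ bad, dyadicCube 2 J k ⊆ ⋃ i, Metric.closedBall (c i) (3 * ε₀) := by
    refine Set.iUnion₂_subset fun k hk x hx => ?_
    obtain ⟨hk, y, hyQ, hyA⟩ := Finset.mem_filter.1 hk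
    obtain ⟨i, hi⟩ := Set.mem_iUnion.1 (hsub hyA)
    refine Set.mem_iUnion.2 ⟨i, ?_⟩
    have h1 := dist_le_of_mem_dyadicCube (mem_dyadicIndices.1 hk) hx hyQ
    have h2 := Metric.mem_closedBall.1 hi
    exact Metric.mem_closedBall.2 (by linarith [dist_triangle x y (c i)])
  have hNpos : (0 : ℝ) ≤ N * (2 * (3 * ε₀)) ^ 2 := by positivity
  calc _ = ∑ k ∈ dyadicIndices 2 J, 2 * min (volume.real (dyadicCube 2 J k ∩ A))
        (volume.real (dyadicCube 2 J k \ A)) := hsum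
    _ ≤ ∑ k ∈ dyadicIndices 2 J, if (dyadicCube 2 J k ∩ frontier A).Nonempty
        then volume.real (dyadicCube 2 J k) else 0 := by
      refine Finset.sum_le_sum fun k hk => ?_
      split_ifs with h
      · exact two_mul_min_measureReal_le hAm (volume_dyadicCube_ne_top (mem_dyadicIndices.1 hk))
      · rw [min_measureReal_eq_zero (convex_dyadicCube 2 J k).isPreconnected h, mul_zero]
    _ = ∑ k ∈ bad, volume.real (dyadicCube 2 J k) := (Finset.sum_filter _ _).symm
    _ = volume.real (⋃ k ∈ bad, dyadicCube 2 J k) :=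
      (measureReal_biUnion_finset
        ((pairwiseDisjoint_dyadicCube 2 J).subset (Finset.coe_subset.2 (Finset.filter_subset _ _)))
        (fun k _ => measurableSet_dyadicCube 2 J k)
        (fun k hk => volume_dyadicCube_ne_top
          (mem_dyadicIndices.1 (Finset.mem_filter.1 hk).1))).symm
    _ ≤ N * (2 * (3 * ε₀)) ^ 2 :=
      ENNReal.toReal_le_of_le_ofReal hNpos
        ((measure_mono hbad).trans (volume_iUnion_closedBall_le c (by positivity)))
    _ ≤ 36 * ε := by
      nlinarith [mul_le_mul_of_nonneg_right hN (sq_nonneg ε₀)]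
end
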